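/- arXiv:1104.3480 — 3 statements merged into one kernel-verified Lean document; each statement's English description precedes it below -/
import Mathlib

section
/- Let V be an n-dimensional real vector space, let B be the natural symmetric pairing on V ⊕ V*, and let J be a linear complex structure on V ⊕ V* (i.e. J ∘ J = -id) that preserves B, meaning B(Ju, Jv) = B(u,v) for all u, v. Let L ⊂ (V ⊕ V*) ⊗ ℂ be the eigenspace of the complexification of J for the eigenvalue i. Then: (1) L is isotropic for the complexified pairing Bᶜ, i.e. Bᶜ(u,v) = 0 for all u, v ∈ L; (2) L has complex dimension n (so L is maximal isotropic); and (3) L ∩ σ(L) = {0}, where σ denotes the conjugation map on (V ⊕ V*) ⊗ ℂ. -/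
open TensorProduct

theorem stmt4_aux (W : Type*) [AddCommGroup W] [Module ℝ W] [FiniteDimensional ℝ W]
    (n : ℕ) (hn : Module.finrank ℝ W = 2 * n)
    (B : W → W → ℝ)
    (J : W →ₗ[ℝ] W)
    (hJ2 : ∀ u, J (J u) = -u)
    (hJB : ∀ u v, B (J u) (J v) = B u v)
    (Jc : (ℂ ⊗[ℝ] W) →ₗ[ℂ] (ℂ ⊗[ℝ] W))
    (hJc : ∀ w : W, Jc (1 ⊗ₜ[ℝ] w) = 1 ⊗ₜ[ℝ] (J w))
    (Bc : (ℂ ⊗[ℝ] W) →ₗ[ℂ] (ℂ ⊗[ℝ] W) →ₗ[ℂ] ℂ)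
    (hBc : ∀ u v : W, Bc (1 ⊗ₜ[ℝ] u) (1 ⊗ₜ[ℝ] v) = (B u v : ℂ))
    (σ : (ℂ ⊗[ℝ] W) →ₗ[ℝ] (ℂ ⊗[ℝ] W))
    (hσ : ∀ (z : ℂ) (w : W), σ (z ⊗ₜ[ℝ] w) = (starRingEnd ℂ z) ⊗ₜ[ℝ] w) 
    (L : Submodule ℂ (ℂ ⊗[ℝ] W)) (hL : ∀ x, x ∈ L ↔ Jc x = Complex.I • x) :
      (∀ u ∈ L, ∀ v ∈ L, Bc u v = 0) ∧
      Module.finrank ℂ L = n ∧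
      (∀ u ∈ L, (∃ v ∈ L, σ v = u) → u = 0) := by
  have ht : ∀ (z : ℂ) (w : W), z ⊗ₜ[ℝ] w = z • ((1:ℂ) ⊗ₜ[ℝ] w) := by
    intro z w; rw [TensorProduct.smul_tmul']; simp
  have hJt : ∀ (z : ℂ) (w : W), Jc (z ⊗ₜ[ℝ] w) = z ⊗ₜ[ℝ] J w := by
    intro z w; rw [ht, map_smul, hJc, ← ht]
  have hJJ : ∀ x, Jc (Jc x) = -x := by
    intro x
    induction x with
    | zero => simp
    | tmul z w => rw [hJt, hJt, hJ2, TensorProduct.tmul_neg]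
    | add x y hx hy => rw [map_add, map_add, hx, hy]; abel
  have hBB : ∀ x y, Bc (Jc x) (Jc y) = Bc x y := by
    intro x y
    induction x with
    | zero => simp
    | add x y hx hy => simp only [map_add, LinearMap.add_apply, hx, hy]
    | tmul z w =>
      induction y with
      | zero => simp
      | add x y hx hy => simp only [map_add, hx, hy]
      | tmul z' w' =>
        rw [hJt, hJt, ht z, ht z', ht z w, ht z' w']
        simp only [map_smul, LinearMap.smul_apply, hBc, hJB]
  have hσJ : ∀ x, Jc (σ x) = σ (Jc x) := by
    intro x
    induction x with
    | zero => simp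
    | tmul z w => rw [hσ, hJt, hJt, hσ]
    | add x y hx hy => simp only [map_add, hx, hy]
  have hσs : ∀ (c : ℂ) x, σ (c • x) = (starRingEnd ℂ c) • σ x := by
    intro c x
    induction x with
    | zero => simp
    | tmul z w => rw [hσ, TensorProduct.smul_tmul', hσ, TensorProduct.smul_tmul']; simp
    | add x y hx hy => simp only [map_add, smul_add, hx, hy]
  have hσσ : ∀ x, σ (σ x) = x := by
    intro x
    induction x with
    | zero => simp
    | tmul z w => rw [hσ, hσ]; simp
    | add x y hx hy => simp only [map_add, hx, hy]
  have hneg : ∀ v ∈ L, Jc (σ v) = -(Complex.I • σ v) := by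
    intro v hv
    rw [hσJ, (hL v).1 hv, hσs]; simp
  refine ⟨?_, ?_, ?_⟩
  · intro u hu v hv
    have h := hBB u v
    rw [(hL u).1 hu, (hL v).1 hv] at h
    simp only [map_smul, LinearMap.smul_apply, smul_eq_mul, ← mul_assoc, Complex.I_mul_I] at h
    linear_combination (-1/2 : ℂ) * h
  · let A : (ℂ ⊗[ℝ] W) →ₗ[ℂ] (ℂ ⊗[ℝ] W) := Jc - Complex.I • LinearMap.id
    have hA : ∀ x, A x = Jc x - Complex.I • x := fun x => rfl
    have hk : LinearMap.ker A = L := by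
      ext x; rw [LinearMap.mem_ker, hA, hL, sub_eq_zero]
    have hr : ∀ x, x ∈ LinearMap.range A ↔ Jc x = -(Complex.I • x) := by
      intro x
      constructor
      · rintro ⟨y, rfl⟩
        rw [hA, map_sub, map_smul, hJJ, smul_sub, smul_smul, Complex.I_mul_I]
        simp [sub_eq_add_neg]
      · intro h
        refine ⟨(Complex.I / 2) • x, ?_⟩
        rw [hA, map_smul, h, smul_neg, smul_smul, smul_smul, ← neg_smul, ← sub_smul]
        have : -(Complex.I / 2 * Complex.I) - Complex.I * (Complex.I / 2) = 1 := by
          linear_combination (-1 : ℂ) * Complex.I_mul_I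
        rw [this, one_smul]
    have hmap : (L.restrictScalars ℝ).map σ = (LinearMap.range A).restrictScalars ℝ := by
      ext x
      rw [Submodule.restrictScalars_mem, hr]
      constructor
      · rintro ⟨v, hv, rfl⟩
        exact hneg v hv
      · intro h
        refine ⟨σ x, ?_, hσσ x⟩
        change σ x ∈ L
        rw [hL, hσJ, h, map_neg, hσs]; simp
    have hinj : Function.Injective σ := fun a b h => by rw [← hσσ a, h, hσσ]
    have e1 := (Submodule.equivMapOfInjective σ hinj (L.restrictScalars ℝ)).finrank_eq.symm
    rw [hmap] at e1
    have e2 := Module.finrank_mul_finrank ℝ ℂ L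
    have e3 := Module.finrank_mul_finrank ℝ ℂ (LinearMap.range A)
    have e4 := LinearMap.finrank_range_add_finrank_ker A
    rw [hk, Module.finrank_baseChange, hn] at e4
    rw [Complex.finrank_real_complex] at e2 e3
    change Module.finrank ℝ (LinearMap.range A) = Module.finrank ℝ L at e1
    omega
  · rintro u hu ⟨v, hv, rfl⟩
    have h1 := hneg v hv
    rw [(hL _).1 hu, eq_neg_iff_add_eq_zero, ← two_smul ℂ, smul_smul] at h1
    rcases smul_eq_zero.1 h1 with h | h
    · simp at h
    · exact h


set_option maxSynthPendingDepth 3 in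
/-- If `J` is a linear complex structure on `W = V ⊕ V*` preserving the natural
symmetric pairing `B`, and `L` is the `+i`-eigenspace of the complexification `Jc` of `J`,
then `L` is isotropic for the complexified pairing `Bc`, has complex dimension `n = dim V`
(hence is maximal isotropic), and satisfies `L ∩ σ(L) = {0}` where `σ` is conjugation. -/
theorem stmt4 (V : Type*) [AddCommGroup V] [Module ℝ V] [FiniteDimensional ℝ V]
    (n : ℕ) (hn : Module.finrank ℝ V = n)
    (B : (V × Module.Dual ℝ V) → (V × Module.Dual ℝ V) → ℝ)
    (hB : ∀ u v : V × Module.Dual ℝ V, B u v = (1 / 2) * (v.2 u.1 + u.2 v.1))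
    (J : (V × Module.Dual ℝ V) →ₗ[ℝ] (V × Module.Dual ℝ V))
    (hJ2 : ∀ u, J (J u) = -u)
    (hJB : ∀ u v, B (J u) (J v) = B u v)
    -- `Jc` is the complexification of `J`:
    (Jc : (ℂ ⊗[ℝ] (V × Module.Dual ℝ V)) →ₗ[ℂ] (ℂ ⊗[ℝ] (V × Module.Dual ℝ V)))
    (hJc : ∀ w : V × Module.Dual ℝ V, Jc (1 ⊗ₜ[ℝ] w) = 1 ⊗ₜ[ℝ] (J w))
    -- `Bc` is the complex-bilinear extension of `B`:
    (Bc : (ℂ ⊗[ℝ] (V × Module.Dual ℝ V)) →ₗ[ℂ]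
          (ℂ ⊗[ℝ] (V × Module.Dual ℝ V)) →ₗ[ℂ] ℂ)
    (hBc : ∀ u v : V × Module.Dual ℝ V,
        Bc (1 ⊗ₜ[ℝ] u) (1 ⊗ₜ[ℝ] v) = (B u v : ℂ))
    -- `σ` is the conjugation map on the complexification:
    (σ : (ℂ ⊗[ℝ] (V × Module.Dual ℝ V)) →ₗ[ℝ] (ℂ ⊗[ℝ] (V × Module.Dual ℝ V)))
    (hσ : ∀ (z : ℂ) (w : V × Module.Dual ℝ V),
        σ (z ⊗ₜ[ℝ] w) = (starRingEnd ℂ z) ⊗ₜ[ℝ] w) :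
    ∀ L : Submodule ℂ (ℂ ⊗[ℝ] (V × Module.Dual ℝ V)),
      L = Module.End.eigenspace (R := ℂ) (M := ℂ ⊗[ℝ] (V × Module.Dual ℝ V))
            Jc Complex.I →
      (∀ u ∈ L, ∀ v ∈ L, Bc u v = 0) ∧
      Module.finrank ℂ L = n ∧
      (∀ u ∈ L, (∃ v ∈ L, σ v = u) → u = 0) := by
  intro L hL
  refine stmt4_aux (V × Module.Dual ℝ V) n ?_ B J hJ2 hJB Jc hJc Bc hBc σ hσ L ?_
  · rw [Module.finrank_prod, Subspace.dual_finrank_eq, hn]; ring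
  · intro x
    rw [hL, Module.End.mem_eigenspace_iff]
end

section
/- Let p be a natural number. The presented group on four generators x, y, a, b with relators [x,a], [y,a], x^p·[b⁻¹,y⁻¹]⁻¹, y·[x⁻¹,b]⁻¹, and b is isomorphic to the direct product (ℤ/pℤ) × ℤ. (This is the fundamental group computation π₁(X_p(1)) ≅ ℤ/pℤ ⊕ ℤ for the manifold X_p(1) ≅ L(p,1) × S¹ obtained from the 4-torus by torus surgeries.) -/
namespace Stmt7

/-- The commutator `[u,v] = u·v·u⁻¹·v⁻¹` in the free group on four generators. -/
def cmm (u v : FreeGroup (Fin 4)) : FreeGroup (Fin 4) := u * v * u⁻¹ * v⁻¹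

def x : FreeGroup (Fin 4) := FreeGroup.of 0
def y : FreeGroup (Fin 4) := FreeGroup.of 1
def a : FreeGroup (Fin 4) := FreeGroup.of 2
def b : FreeGroup (Fin 4) := FreeGroup.of 3

/-- The relators for the fundamental group of the manifold `X_p(1)`. -/
def rels (p : ℕ) : Set (FreeGroup (Fin 4)) :=
  { cmm x a, cmm y a, x ^ p * (cmm b⁻¹ y⁻¹)⁻¹, y * (cmm x⁻¹ b)⁻¹, b }

end Stmt7

namespace Stmt7

def fwd (p : ℕ) : Fin 4 → Multiplicative (ZMod p × ℤ) :=
  ![Multiplicative.ofAdd (1, 0), 1, Multiplicative.ofAdd (0, 1), 1]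

theorem fwd_rels (p : ℕ) : ∀ r ∈ rels p, FreeGroup.lift (fwd p) r = 1 := by
  intro r hr
  simp only [rels, Set.mem_insert_iff, Set.mem_singleton_iff] at hr
  rcases hr with rfl | rfl | rfl | rfl | rfl
  · simp [cmm, x, a, mul_comm]
  · simp [cmm, y, a, mul_comm]
  · simp [cmm, x, y, b, fwd, ← ofAdd_nsmul]
  · simp [cmm, x, y, b, fwd]
  · simp [b, fwd]

theorem normal_form (p : ℕ) (X A : PresentedGroup (rels p))
    (hX : X = PresentedGroup.of 0) (hA : A = PresentedGroup.of 2) :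
    X ^ p = 1 ∧ ∀ g : PresentedGroup (rels p), ∃ m n : ℤ, g = X ^ m * A ^ n := by
  have key : ∀ r ∈ rels p, PresentedGroup.mk (rels p) r = 1 := fun r hr =>
    PresentedGroup.one_of_mem hr
  have h1 := key (cmm x a) (by simp [rels])
  have h3 := key (x ^ p * (cmm b⁻¹ y⁻¹)⁻¹) (by simp [rels])
  have h4 := key (y * (cmm x⁻¹ b)⁻¹) (by simp [rels])
  have h5 := key b (by simp [rels])
  have ex : PresentedGroup.mk (rels p) x = X := hX.symm
  have ea : PresentedGroup.mk (rels p) a = A := hA.symm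
  simp only [cmm, map_mul, map_inv, map_pow, ex, ea, h5] at h1 h3 h4
  have hy : PresentedGroup.mk (rels p) y = 1 := by simpa using h4
  have hxp : X ^ p = 1 := by simpa [hy] using h3
  have hc : Commute X A := by
    have := mul_inv_eq_one.mp h1
    exact mul_inv_eq_iff_eq_mul.mp this
  refine ⟨hxp, fun g => ?_⟩
  have hg : g ∈ Subgroup.closure (Set.range (PresentedGroup.of (rels := rels p))) := by
    rw [PresentedGroup.closure_range_of]; trivial
  induction hg using Subgroup.closure_induction with
  | mem g hg =>
    obtain ⟨i, rfl⟩ := hg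
    fin_cases i
    · exact ⟨1, 0, by simp [hX]⟩
    · exact ⟨0, 0, by simp only [zpow_zero, mul_one]; exact hy⟩
    · exact ⟨0, 1, by simp [hA]⟩
    · exact ⟨0, 0, by simp only [zpow_zero, mul_one]; exact h5⟩
  | one => exact ⟨0, 0, by simp⟩
  | mul g h _ _ ihg ihh =>
    obtain ⟨m, n, rfl⟩ := ihg
    obtain ⟨k, l, rfl⟩ := ihh
    refine ⟨m + k, n + l, ?_⟩
    have := (hc.zpow_zpow k n).eq
    rw [zpow_add, zpow_add, mul_assoc, ← mul_assoc (A ^ n), ← this]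
    simp only [mul_assoc]
  | inv g _ ih =>
    obtain ⟨m, n, rfl⟩ := ih
    refine ⟨-m, -n, ?_⟩
    rw [(hc.zpow_zpow m n).eq, mul_inv_rev, zpow_neg, zpow_neg]

end Stmt7

/-- The presented group
`⟨x, y, a, b ∣ [x,a], [y,a], xᵖ[b⁻¹,y⁻¹]⁻¹, y[x⁻¹,b]⁻¹, b⟩`
is isomorphic to `(ℤ/pℤ) × ℤ` (the fundamental group `π₁(X_p(1)) ≅ ℤ/pℤ ⊕ ℤ`). -/
theorem stmt7 (p : ℕ) :
    Nonempty (PresentedGroup (Stmt7.rels p) ≃* Multiplicative (ZMod p × ℤ)) := by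
  let f := PresentedGroup.toGroup (Stmt7.fwd_rels p)
  have f0 : f (PresentedGroup.of 0) = Multiplicative.ofAdd (1, 0) := by
    simp [f, Stmt7.fwd]
  have f2 : f (PresentedGroup.of 2) = Multiplicative.ofAdd (0, 1) := by
    simp [f, Stmt7.fwd]
  have fv : ∀ m n : ℤ, f (PresentedGroup.of 0 ^ m * PresentedGroup.of 2 ^ n)
      = Multiplicative.ofAdd ((m : ZMod p), n) := by
    intro m n
    rw [map_mul, map_zpow, map_zpow, f0, f2, ← ofAdd_zsmul, ← ofAdd_zsmul, ← ofAdd_add]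
    simp
  obtain ⟨hxp, hnf⟩ := Stmt7.normal_form p _ _ rfl rfl
  refine ⟨MulEquiv.ofBijective f ⟨?_, ?_⟩⟩
  · rw [injective_iff_map_eq_one]
    intro g hg
    obtain ⟨m, n, rfl⟩ := hnf g
    rw [fv, ofAdd_eq_one, Prod.mk_eq_zero] at hg
    obtain ⟨hm, rfl⟩ := hg
    obtain ⟨k, rfl⟩ := (ZMod.intCast_zmod_eq_zero_iff_dvd m p).mp hm
    rw [zpow_mul, zpow_natCast, hxp]
    simp
  · intro z
    obtain ⟨m, hm⟩ := ZMod.intCast_surjective (Multiplicative.toAdd z).1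
    refine ⟨_, (fv m (Multiplicative.toAdd z).2).trans ?_⟩
    rw [hm]
    rfl
end

section
/- Let g ≥ 2. The presented group on 2g + 2 generators x, y, a₁, …, a_g, b₁, …, b_g with relators: [x,y]; [x,a_i], [y,a_i], and [y, b_i·a_i·b_i⁻¹] for each i = 1, …, g; the relator [a₁,b₁]·[a₂,b₂]⋯[a_g,b_g]; together with the relators y, a₁·[b₁⁻¹,y⁻¹]⁻¹, x·[b₂⁻¹,y⁻¹]⁻¹, and (b_i·a_i·b_i⁻¹)·[x⁻¹,b_i]⁻¹ for each i = 2, …, g, is isomorphic to the free group on g generators b₁, …, b_g. (This is the fundamental group computation π₁(X_{F,g}) ≅ ℤ ∗ ⋯ ∗ ℤ (g factors) for the manifold obtained from T² × Σ_g by g + 1 Luttinger surgeries and one (1,0,0)-torus surgery.) -/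
namespace Stmt9

/-- Generators `x, y, a₁, …, a_g, b₁, …, b_g`. -/
inductive Gen (g : ℕ)
  | x
  | y
  | a (i : Fin g)
  | b (i : Fin g)

/-- The commutator `[u,v] = u·v·u⁻¹·v⁻¹`. -/
def cmm {α : Type*} (u v : FreeGroup α) : FreeGroup α := u * v * u⁻¹ * v⁻¹

def X (g : ℕ) : FreeGroup (Gen g) := FreeGroup.of Gen.x
def Y (g : ℕ) : FreeGroup (Gen g) := FreeGroup.of Gen.y
def A {g : ℕ} (i : Fin g) : FreeGroup (Gen g) := FreeGroup.of (Gen.a i)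
def B {g : ℕ} (i : Fin g) : FreeGroup (Gen g) := FreeGroup.of (Gen.b i)

/-- The product `[a₁,b₁]·[a₂,b₂]⋯[a_g,b_g]`. -/
def surfaceRel (g : ℕ) : FreeGroup (Gen g) :=
  (List.ofFn fun i : Fin g => cmm (A i) (B i)).prod

/-- The relators: `[x,y]`; `[x,aᵢ]`, `[y,aᵢ]`, `[y, bᵢaᵢbᵢ⁻¹]` for each `i = 1, …, g`;
`[a₁,b₁]⋯[a_g,b_g]`; together with `y`, `a₁[b₁⁻¹,y⁻¹]⁻¹`, `x[b₂⁻¹,y⁻¹]⁻¹`, and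
`(bᵢaᵢbᵢ⁻¹)[x⁻¹,bᵢ]⁻¹` for each `i = 2, …, g` (1-based indexing). -/
def rels (g : ℕ) (hg : 2 ≤ g) : Set (FreeGroup (Gen g)) :=
  { cmm (X g) (Y g), surfaceRel g, Y g,
    A (⟨0, by omega⟩ : Fin g) * (cmm (B (⟨0, by omega⟩ : Fin g))⁻¹ (Y g)⁻¹)⁻¹,
    X g * (cmm (B (⟨1, by omega⟩ : Fin g))⁻¹ (Y g)⁻¹)⁻¹ } ∪
  (⋃ i : Fin g,
    { cmm (X g) (A i), cmm (Y g) (A i), cmm (Y g) (B i * A i * (B i)⁻¹) }) ∪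
  { w | ∃ i : Fin g, 0 < i.1 ∧ w = (B i * A i * (B i)⁻¹) * (cmm (X g)⁻¹ (B i))⁻¹ }

end Stmt9

namespace Stmt9

def genMap (g : ℕ) : Gen g → FreeGroup (Fin g)
  | Gen.x => 1
  | Gen.y => 1
  | Gen.a _ => 1
  | Gen.b i => FreeGroup.of i

theorem genMap_rels (g : ℕ) (hg : 2 ≤ g) :
    ∀ r ∈ rels g hg, FreeGroup.lift (genMap g) r = 1 := by
  have hX : FreeGroup.lift (genMap g) (X g) = 1 := by simp [X, genMap]
  have hY : FreeGroup.lift (genMap g) (Y g) = 1 := by simp [Y, genMap]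
  have hA : ∀ i : Fin g, FreeGroup.lift (genMap g) (A i) = 1 := fun i => by simp [A, genMap]
  intro r hr
  rcases hr with (hr | hr) | hr
  · rcases hr with rfl | rfl | rfl | rfl | rfl
    · simp [cmm, hX, hY]
    · rw [surfaceRel, map_list_prod]
      apply List.prod_eq_one
      intro w hw
      simp only [List.map_ofFn, List.mem_ofFn] at hw
      obtain ⟨i, rfl⟩ := hw
      simp [cmm, hA]
    · exact hY
    · simp [cmm, hA, hY]
    · simp [cmm, hX, hY]
  · obtain ⟨i, hi⟩ := Set.mem_iUnion.1 hr
    rcases hi with rfl | rfl | rfl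
    · simp [cmm, hA, hX]
    · simp [cmm, hA, hY]
    · simp [cmm, hA, hY]
  · obtain ⟨i, -, rfl⟩ := hr
    simp [cmm, hA, hX]

section
variable (g : ℕ) (hg : 2 ≤ g)

theorem mk_Y : PresentedGroup.mk (rels g hg) (Y g) = 1 :=
  PresentedGroup.one_of_mem (Or.inl (Or.inl (by simp)))

theorem mk_X : PresentedGroup.mk (rels g hg) (X g) = 1 := by
  have h : PresentedGroup.mk (rels g hg)
      (X g * (cmm (B (⟨1, by omega⟩ : Fin g))⁻¹ (Y g)⁻¹)⁻¹) = 1 :=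
    PresentedGroup.one_of_mem (Or.inl (Or.inl (by simp)))
  simpa [cmm, mk_Y] using h

theorem mk_A (i : Fin g) : PresentedGroup.mk (rels g hg) (A i) = 1 := by
  by_cases hi : 0 < i.1
  · have h : PresentedGroup.mk (rels g hg)
        ((B i * A i * (B i)⁻¹) * (cmm (X g)⁻¹ (B i))⁻¹) = 1 :=
      PresentedGroup.one_of_mem (Or.inr ⟨i, hi, rfl⟩)
    simpa [cmm, mk_X] using h
  · have h : PresentedGroup.mk (rels g hg)
        (A (⟨0, by omega⟩ : Fin g) * (cmm (B (⟨0, by omega⟩ : Fin g))⁻¹ (Y g)⁻¹)⁻¹) = 1 :=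
      PresentedGroup.one_of_mem (Or.inl (Or.inl (by simp)))
    have e : i = ⟨0, by omega⟩ := Fin.ext (by simpa using hi)
    rw [e]
    simpa [cmm, mk_Y] using h

end

end Stmt9

/-- For `g ≥ 2`, the presented group
`⟨x, y, a₁, …, a_g, b₁, …, b_g ∣ [x,y], [x,aᵢ], [y,aᵢ], [y,bᵢaᵢbᵢ⁻¹] (i = 1,…,g),
[a₁,b₁]⋯[a_g,b_g], y, a₁[b₁⁻¹,y⁻¹]⁻¹, x[b₂⁻¹,y⁻¹]⁻¹, (bᵢaᵢbᵢ⁻¹)[x⁻¹,bᵢ]⁻¹ (i = 2,…,g)⟩`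
is isomorphic to the free group on `g` generators `b₁, …, b_g`. -/
theorem stmt9 (g : ℕ) (hg : 2 ≤ g) :
    Nonempty (PresentedGroup (Stmt9.rels g hg) ≃* FreeGroup (Fin g)) := by
  refine ⟨MonoidHom.toMulEquiv
    (PresentedGroup.toGroup (Stmt9.genMap_rels g hg))
    (FreeGroup.lift fun i => PresentedGroup.mk (Stmt9.rels g hg) (Stmt9.B i)) ?_ ?_⟩
  · apply PresentedGroup.ext
    intro z
    cases z with
    | x => simp [Stmt9.genMap]; exact (Stmt9.mk_X g hg).symm
    | y => simp [Stmt9.genMap]; exact (Stmt9.mk_Y g hg).symm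
    | a i => simp [Stmt9.genMap]; exact (Stmt9.mk_A g hg i).symm
    | b i => simp [Stmt9.genMap]; rfl
  · apply FreeGroup.ext_hom
    intro i
    have h := PresentedGroup.toGroup.of (Stmt9.genMap_rels g hg) (x := Stmt9.Gen.b i)
    simp only [MonoidHom.comp_apply, FreeGroup.lift_apply_of, MonoidHom.id_apply]
    exact h
end
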